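/- Let n ∈ ℕ and let D ∈ Matrix n n ℝ be symmetric. Define ρ_D : ℝⁿ → ℝ by ρ_D(r) = rᵀ D² r − (1/2)·trace(D²) − (1/4)·(rᵀ D r − trace(D))². Then for every matrix A ∈ Matrix n n ℝ, every vector b ∈ ℝⁿ and every scalar c ∈ ℝ, the Gaussian-weighted integral vanishes: ∫_{ℝⁿ} exp(−‖r‖²/2) · ρ_D(r) · (rᵀ A r + b·r + c) dr = 0. That is, ρ_D is orthogonal to all polynomials of total degree at most 2 with respect to the standard Gaussian weight. -/

import Mathlib

open Matrix Real MeasureTheory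

/-- The quadratic form `rᵀ B r = ∑ᵢⱼ rᵢ Bᵢⱼ rⱼ` of a matrix `B`. -/
noncomputable def quadForm {n : ℕ} (B : Matrix (Fin n) (Fin n) ℝ) (r : Fin n → ℝ) : ℝ :=
  ∑ i, ∑ j, r i * B i j * r j

/-- The spatial remainder term associated with a symmetric matrix `D`:
`ρ_D(r) = rᵀ D² r − (1/2) tr(D²) − (1/4)(rᵀ D r − tr D)²`. -/
noncomputable def rhoD {n : ℕ} (D : Matrix (Fin n) (Fin n) ℝ) (r : Fin n → ℝ) : ℝ :=
  quadForm (D * D) r - (1 / 2) * (D * D).trace - (1 / 4) * (quadForm D r - D.trace) ^ 2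

/-- One-dimensional weighted monomials are integrable. -/
lemma aux_int1 (k : ℕ) : Integrable (fun x : ℝ => x ^ k * Real.exp (-(x ^ 2) / 2)) := by
  have h := integrable_rpow_mul_exp_neg_mul_sq (b := 1 / 2) (by norm_num) (s := (k : ℝ))
    (by have : (0 : ℝ) ≤ k := Nat.cast_nonneg k
        linarith)
  refine h.congr (Filter.Eventually.of_forall fun x => ?_)
  simp only [Real.rpow_natCast]
  congr 2
  ring

/-- Moment of the one-dimensional weight. -/
noncomputable def mom (k : ℕ) : ℝ := ∫ x : ℝ, x ^ k * Real.exp (-(x ^ 2) / 2)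

lemma mom_succ (k : ℕ) : mom (k + 1) = k * mom (k - 1) := by
  have hd : ∀ x : ℝ, HasDerivAt (fun x : ℝ => x ^ k * Real.exp (-(x ^ 2) / 2))
      (k * (x ^ (k - 1) * Real.exp (-(x ^ 2) / 2)) - x ^ (k + 1) * Real.exp (-(x ^ 2) / 2)) x := by
    intro x
    have h1 : HasDerivAt (fun x : ℝ => -(x ^ 2) / 2) (-x) x := by
      have := ((hasDerivAt_pow 2 x).neg).div_const 2
      refine this.congr_deriv ?_
      norm_num
      ring
    refine ((hasDerivAt_pow k x).mul h1.exp).congr_deriv ?_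
    ring
  have h := integral_eq_zero_of_hasDerivAt_of_integrable hd
    (((aux_int1 (k - 1)).const_mul _).sub (aux_int1 (k + 1))) (aux_int1 k)
  rw [integral_sub ((aux_int1 (k - 1)).const_mul _) (aux_int1 (k + 1)), integral_const_mul] at h
  unfold mom
  linarith

/-- The Gaussian weight. -/
noncomputable def gw {n : ℕ} (r : Fin n → ℝ) : ℝ := Real.exp (-(∑ i, r i ^ 2) / 2)

lemma gw_monomial {n : ℕ} (s : Fin n →₀ ℕ) (a : ℝ) (r : Fin n → ℝ) :
    gw r * MvPolynomial.eval r (MvPolynomial.monomial s a)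
      = a * ∏ i, (r i ^ s i * Real.exp (-(r i ^ 2) / 2)) := by
  rw [MvPolynomial.eval_monomial, Finset.prod_mul_distrib, ← Real.exp_sum, gw,
    Finsupp.prod_fintype _ _ (by simp), ← Finset.sum_div, Finset.sum_neg_distrib]
  ring

lemma gw_integrable {n : ℕ} (p : MvPolynomial (Fin n) ℝ) :
    Integrable (fun r : Fin n → ℝ => gw r * MvPolynomial.eval r p) := by
  induction p using MvPolynomial.induction_on' with
  | monomial s a =>
    simp_rw [gw_monomial]
    exact (Integrable.fintype_prod (fun i => aux_int1 (s i))).const_mul a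
  | add p q hp hq =>
    simp_rw [map_add, mul_add]
    exact hp.add hq

/-- Gaussian functional on polynomials. -/
noncomputable def gL {n : ℕ} : MvPolynomial (Fin n) ℝ →ₗ[ℝ] ℝ where
  toFun p := ∫ r : Fin n → ℝ, gw r * MvPolynomial.eval r p
  map_add' p q := by
    simp_rw [map_add, mul_add]
    exact integral_add (gw_integrable p) (gw_integrable q)
  map_smul' c p := by
    simp_rw [MvPolynomial.smul_eval, RingHom.id_apply, smul_eq_mul, ← integral_const_mul]
    congr 1
    ext r
    ring

lemma gL_monomial {n : ℕ} (s : Fin n →₀ ℕ) (a : ℝ) :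
    gL (MvPolynomial.monomial s a) = a * ∏ i, mom (s i) := by
  change ∫ r : Fin n → ℝ, gw r * MvPolynomial.eval r (MvPolynomial.monomial s a) = _
  simp_rw [gw_monomial, integral_const_mul]
  rw [integral_fintype_prod_volume_eq_prod (fun i x => x ^ s i * Real.exp (-(x ^ 2) / 2))]
  rfl

lemma gL_stein {n : ℕ} (i : Fin n) (p : MvPolynomial (Fin n) ℝ) :
    gL (MvPolynomial.X i * p) = gL (MvPolynomial.pderiv i p) := by
  induction p using MvPolynomial.induction_on' with
  | monomial s a =>
    rw [MvPolynomial.pderiv_monomial, MvPolynomial.X, MvPolynomial.monomial_mul, gL_monomial,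
      gL_monomial, ← Finset.mul_prod_erase _ _ (Finset.mem_univ i),
      ← Finset.mul_prod_erase _ _ (Finset.mem_univ i)]
    have h1 : ∏ j ∈ Finset.univ.erase i, mom ((Finsupp.single i 1 + s : Fin n →₀ ℕ) j)
        = ∏ j ∈ Finset.univ.erase i, mom (s j) :=
      Finset.prod_congr rfl fun j hj => by
        simp [Finsupp.single_apply, (Finset.ne_of_mem_erase hj).symm]
    have h2 : ∏ j ∈ Finset.univ.erase i, mom ((s - Finsupp.single i 1 : Fin n →₀ ℕ) j)
        = ∏ j ∈ Finset.univ.erase i, mom (s j) :=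
      Finset.prod_congr rfl fun j hj => by
        simp [Finsupp.single_apply, (Finset.ne_of_mem_erase hj).symm]
    rw [h1, h2]
    simp only [Finsupp.add_apply, Finsupp.tsub_apply, Finsupp.single_eq_same]
    rw [add_comm 1, mom_succ]
    ring
  | add p q hp hq => rw [mul_add, map_add, map_add, map_add, hp, hq]

lemma gL_delta {n : ℕ} (i : Fin n) (q f : MvPolynomial (Fin n) ℝ) :
    gL (q * (MvPolynomial.X i * f - MvPolynomial.pderiv i f))
      = gL (MvPolynomial.pderiv i q * f) := by
  have h := gL_stein i (q * f)
  rw [Derivation.leibniz, map_add, smul_eq_mul, smul_eq_mul] at h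
  have e : q * (MvPolynomial.X i * f - MvPolynomial.pderiv i f)
    = MvPolynomial.X i * (q * f) - q * MvPolynomial.pderiv i f := by ring
  rw [e, map_sub, h, mul_comm f]
  ring

section
open MvPolynomial

/-- Quadratic form as a polynomial. -/
noncomputable def qP {n : ℕ} (D : Matrix (Fin n) (Fin n) ℝ) : MvPolynomial (Fin n) ℝ :=
  ∑ i, ∑ j, X i * C (D i j) * X j

/-- The linear form `(D r)_i` as a polynomial. -/
noncomputable def uP {n : ℕ} (D : Matrix (Fin n) (Fin n) ℝ) (i : Fin n) :
    MvPolynomial (Fin n) ℝ := ∑ j, C (D i j) * X j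

lemma qP_eq {n : ℕ} (D : Matrix (Fin n) (Fin n) ℝ) : qP D = ∑ i, X i * uP D i := by
  simp [qP, uP, Finset.mul_sum, mul_assoc]

lemma pderiv_uP {n : ℕ} (D : Matrix (Fin n) (Fin n) ℝ) (i k : Fin n) :
    pderiv k (uP D i) = C (D i k) := by
  simp [uP, Derivation.leibniz, pderiv_X, Pi.single_apply]

lemma pderiv_qP {n : ℕ} (A : Matrix (Fin n) (Fin n) ℝ) (k : Fin n) :
    pderiv k (qP A) = uP A k + uP Aᵀ k := by
  rw [qP_eq, map_sum]
  simp only [Derivation.leibniz, pderiv_uP, pderiv_X, Pi.single_apply, smul_eq_mul,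
    Finset.sum_add_distrib]
  simp [uP, mul_comm, add_comm]

lemma uP_sq {n : ℕ} (D : Matrix (Fin n) (Fin n) ℝ) (i : Fin n) :
    uP (D * D) i = ∑ j, C (D i j) * uP D j := by
  simp only [uP, Matrix.mul_apply, map_sum, map_mul, Finset.sum_mul, Finset.mul_sum]
  rw [Finset.sum_comm]
  simp only [mul_assoc]

/-- `Q - t`. -/
noncomputable def wP {n : ℕ} (D : Matrix (Fin n) (Fin n) ℝ) : MvPolynomial (Fin n) ℝ :=
  qP D - C D.trace

/-- The first-level field. -/
noncomputable def fP {n : ℕ} (D : Matrix (Fin n) (Fin n) ℝ) (i : Fin n) :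
    MvPolynomial (Fin n) ℝ := uP D i * wP D - 2 * uP (D * D) i

lemma pderiv_wP {n : ℕ} (D : Matrix (Fin n) (Fin n) ℝ) (hD : D.IsSymm) (k : Fin n) :
    pderiv k (wP D) = 2 * uP D k := by
  rw [wP, map_sub, pderiv_qP, hD.eq, pderiv_C]
  ring

lemma fP_eq {n : ℕ} (D : Matrix (Fin n) (Fin n) ℝ) (hD : D.IsSymm) (i : Fin n) :
    fP D i = ∑ j, (X j * (C (D i j) * wP D) - pderiv j (C (D i j) * wP D)) := by
  simp only [pderiv_C_mul, pderiv_wP D hD, Finset.sum_sub_distrib, fP, uP_sq, Finset.mul_sum]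
  congr 1
  · rw [uP, Finset.sum_mul]
    exact Finset.sum_congr rfl fun j _ => by ring
  · exact Finset.sum_congr rfl fun j _ => by ring

lemma wP_eq {n : ℕ} (D : Matrix (Fin n) (Fin n) ℝ) :
    wP D = ∑ i, (X i * uP D i - pderiv i (uP D i)) := by
  simp only [pderiv_uP, Finset.sum_sub_distrib, wP, qP_eq, Matrix.trace, Matrix.diag_apply, map_sum]

/-- `ρ_D` as a polynomial, times `-4`. -/
noncomputable def rP {n : ℕ} (D : Matrix (Fin n) (Fin n) ℝ) : MvPolynomial (Fin n) ℝ :=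
  wP D ^ 2 - 4 * qP (D * D) + 2 * C (D * D).trace

lemma rP_eq {n : ℕ} (D : Matrix (Fin n) (Fin n) ℝ) (hD : D.IsSymm) :
    rP D = ∑ i, (X i * fP D i - pderiv i (fP D i)) := by
  have h2 : ∀ i, pderiv i (2 * uP (D * D) i) = 2 * C ((D * D) i i) := by
    intro i
    rw [two_mul, map_add, pderiv_uP, two_mul]
  have h : ∀ i, X i * fP D i - pderiv i (fP D i) = (X i * uP D i - C (D i i)) * wP D
      - 2 * (X i * uP (D * D) i) + 2 * C ((D * D) i i) - 2 * (uP D i * uP D i) := by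
    intro i
    rw [fP, map_sub, h2, Derivation.leibniz, pderiv_wP D hD, pderiv_uP, smul_eq_mul, smul_eq_mul]
    ring
  have h3 : ∑ i, uP D i * uP D i = qP (D * D) := by
    rw [qP_eq]
    simp only [uP_sq, Finset.mul_sum]
    rw [Finset.sum_comm]
    refine Finset.sum_congr rfl fun j _ => ?_
    have e : uP D j * uP D j = ∑ k, C (D j k) * X k * uP D j := by
      rw [← Finset.sum_mul]
      rfl
    rw [e]
    refine Finset.sum_congr rfl fun i _ => ?_
    rw [hD.apply]
    ring
  simp only [h, Finset.sum_sub_distrib, Finset.sum_add_distrib, ← Finset.mul_sum,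
    ← Finset.sum_mul, h3, ← qP_eq]
  simp only [← map_sum]
  change _ = (qP D - C D.trace) * wP D - 2 * qP (D * D) + 2 * C (D * D).trace - _
  rw [rP, wP]
  ring

lemma gL_wP {n : ℕ} (D : Matrix (Fin n) (Fin n) ℝ) : gL (wP D) = 0 := by
  rw [wP_eq, map_sum]
  refine Finset.sum_eq_zero fun i _ => ?_
  have := gL_delta i 1 (uP D i)
  simpa using this

lemma gL_rP {n : ℕ} (D : Matrix (Fin n) (Fin n) ℝ) (hD : D.IsSymm)
    (q : MvPolynomial (Fin n) ℝ) (hq : ∀ i j, ∃ k, pderiv j (pderiv i q) = C k) :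
    gL (q * rP D) = 0 := by
  rw [rP_eq D hD, Finset.mul_sum, map_sum]
  refine Finset.sum_eq_zero fun i _ => ?_
  rw [gL_delta, fP_eq D hD, Finset.mul_sum, map_sum]
  refine Finset.sum_eq_zero fun j _ => ?_
  obtain ⟨k, hk⟩ := hq i j
  rw [gL_delta, hk, ← mul_assoc, ← C_mul, ← smul_eq_C_mul, map_smul, gL_wP, smul_zero]

lemma eval_qP {n : ℕ} (D : Matrix (Fin n) (Fin n) ℝ) (r : Fin n → ℝ) :
    eval r (qP D) = quadForm D r := by
  simp [qP, quadForm]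

end

/-- The remainder `ρ_D` of a symmetric matrix `D` is orthogonal to all polynomials of total
degree at most two with respect to the standard Gaussian weight. -/
theorem rhoD_orthogonal_degree_two {n : ℕ} (D : Matrix (Fin n) (Fin n) ℝ) (hD : D.IsSymm) :
    ∀ (A : Matrix (Fin n) (Fin n) ℝ) (b : Fin n → ℝ) (c : ℝ),
      ∫ r : Fin n → ℝ,
        Real.exp (-(∑ i, r i ^ 2) / 2) * rhoD D r * (quadForm A r + b ⬝ᵥ r + c) = 0 := by
  intro A b c
  have h := gL_rP D hD
    (qP A + ∑ j, MvPolynomial.C (b j) * MvPolynomial.X j + MvPolynomial.C c) (by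
      intro i j
      refine ⟨A i j + A j i, ?_⟩
      have hb : MvPolynomial.pderiv i
          (∑ j, MvPolynomial.C (b j) * MvPolynomial.X j : MvPolynomial (Fin n) ℝ)
          = MvPolynomial.C (b i) := pderiv_uP (fun _ j => b j) i i
      rw [map_add (MvPolynomial.pderiv i), map_add (MvPolynomial.pderiv i), pderiv_qP, hb, MvPolynomial.pderiv_C, map_add, map_add, map_add,
        pderiv_uP, pderiv_uP, MvPolynomial.pderiv_C]
      simp)
  change ∫ r : Fin n → ℝ, gw r * MvPolynomial.eval r _ = 0 at h
  have h' : ∀ r : Fin n → ℝ,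
      Real.exp (-(∑ i, r i ^ 2) / 2) * rhoD D r * (quadForm A r + b ⬝ᵥ r + c)
      = (-1 / 4) * (gw r * MvPolynomial.eval r
        ((qP A + ∑ j, MvPolynomial.C (b j) * MvPolynomial.X j + MvPolynomial.C c) * rP D)) := by
    intro r
    simp only [map_mul, map_add, map_sub, map_pow, map_sum, rP, wP, eval_qP, MvPolynomial.eval_C,
      MvPolynomial.eval_X, map_ofNat, gw, rhoD, dotProduct]
    ring
  simp_rw [h']
  rw [integral_const_mul, h, mul_zero]
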